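/- Let O ⊆ ℝ^N be open, let v : O → ℝ be any function, and let φ : ℝ → ℝ be twice continuously differentiable with φ'(t) > 0 for every t ∈ ℝ; set w := φ ∘ v. Fix x ∈ O and write s := φ'(v(x)). If (p,Y) ∈ J^{2,−}w(x), then ( p/s , (1/s)·Y − (φ''(v(x))/s³)·p⊗p ) ∈ J^{2,−}v(x), where p⊗p denotes the N×N matrix with entries p_i p_j. -/

import Mathlib

open Matrix Filter Topology

/-- `(p, Y)` belongs to the second-order subjet `J^{2,-} V (x)` of `V : O → ℝ`:
`Y` is symmetric and `V y ≥ V x + p·(y-x) + ½ (y-x)·Y(y-x) + o(|y-x|²)` as `y → x` in `O`. -/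
def InSubjet {d : ℕ} (O : Set (Fin d → ℝ)) (V : (Fin d → ℝ) → ℝ)
    (x p : Fin d → ℝ) (Y : Matrix (Fin d) (Fin d) ℝ) : Prop :=
  Y.IsSymm ∧ ∀ ε > (0 : ℝ), ∃ δ > (0 : ℝ), ∀ y ∈ O, ‖y - x‖ ≤ δ →
    V y ≥ V x + p ⬝ᵥ (y - x) + (1 / 2) * ((y - x) ⬝ᵥ Y *ᵥ (y - x)) - ε * ‖y - x‖ ^ 2

theorem aux_taylor (φ : ℝ → ℝ) (hφ : ContDiff ℝ 2 φ) (A η : ℝ) (hη : 0 < η) :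
    ∃ r > 0, ∀ u : ℝ, |u| < r →
      φ (A + u) ≤ φ A + deriv φ A * u + deriv (deriv φ) A / 2 * u ^ 2 + η * u ^ 2 := by
  have h := taylor_isLittleO_univ (f := φ) (x₀ := A) (n := 2) (by exact_mod_cast hφ)
  have h2 := h.bound hη
  rw [Metric.eventually_nhds_iff] at h2
  obtain ⟨r, hr, h3⟩ := h2
  refine ⟨r, hr, fun u hu => ?_⟩
  have h4 := h3 (y := A + u) (by simpa [Real.dist_eq] using hu)
  rw [taylorWithinEval_succ, taylorWithinEval_succ, taylor_within_zero_eval,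
    iteratedDerivWithin_univ, iteratedDerivWithin_univ, iteratedDeriv_succ, iteratedDeriv_succ,
    iteratedDeriv_zero] at h4
  simp only [Real.norm_eq_abs, add_sub_cancel_left, smul_eq_mul, abs_pow, sq_abs] at h4
  have h5 := (abs_le.mp h4).2
  norm_num [Nat.factorial] at h5
  linarith

theorem aux_dot {N : ℕ} (p : Fin N → ℝ) : ∃ P ≥ 0, ∀ h : Fin N → ℝ, |p ⬝ᵥ h| ≤ P * ‖h‖ := by
  refine ⟨∑ i, |p i|, Finset.sum_nonneg fun i _ => abs_nonneg _, fun h => ?_⟩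
  rw [dotProduct, Finset.sum_mul]
  refine (Finset.abs_sum_le_sum_abs _ _).trans (Finset.sum_le_sum fun i _ => ?_)
  rw [abs_mul]
  exact mul_le_mul_of_nonneg_left (norm_le_pi_norm h i) (abs_nonneg _)

theorem aux_quad {N : ℕ} (Y : Matrix (Fin N) (Fin N) ℝ) :
    ∃ M ≥ 0, ∀ h : Fin N → ℝ, |h ⬝ᵥ Y *ᵥ h| ≤ M * ‖h‖ ^ 2 := by
  choose P hP hPb using fun i => aux_dot (Y i)
  refine ⟨∑ i, P i, Finset.sum_nonneg fun i _ => hP i, fun h => ?_⟩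
  rw [dotProduct, Finset.sum_mul]
  refine (Finset.abs_sum_le_sum_abs _ _).trans (Finset.sum_le_sum fun i _ => ?_)
  rw [abs_mul]
  calc |h i| * |(Y *ᵥ h) i| ≤ ‖h‖ * (P i * ‖h‖) :=
        mul_le_mul (norm_le_pi_norm h i) (hPb i h) (abs_nonneg _) (norm_nonneg _)
    _ = P i * ‖h‖ ^ 2 := by ring

theorem aux_scalar (s c P M ε : ℝ) (hs : 0 < s) (hP : 0 ≤ P) (hM : 0 ≤ M) (hε : 0 < ε) :
    ∃ C > 0, ∀ a b n : ℝ, 0 ≤ n → n ≤ 1 → |a| ≤ P * n → |b| ≤ M * n ^ 2 →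
      ∀ u, u = a / s + (1 / 2) * (b / s - c / s ^ 3 * a ^ 2) - ε * n ^ 2 →
        |u| ≤ C * n ∧ c / 2 * (u ^ 2 - (a / s) ^ 2) ≤ C * n ^ 3 := by
  set D := (1 / 2) * (M / s + |c| / s ^ 3 * P ^ 2) + ε with hD
  have hD0 : 0 < D := by positivity
  set C := P / s + D with hC
  have hC0 : 0 < C := by positivity
  refine ⟨C + |c| / 2 * (D * (2 * C)), by positivity, fun a b n hn hn1 ha hb u hu => ?_⟩
  have e1 : |a / s| ≤ P / s * n := by
    rw [abs_div, abs_of_pos hs, div_mul_eq_mul_div]; gcongr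
  have e2 : |u - a / s| ≤ D * n ^ 2 := by
    have f1 : |b / s| ≤ M / s * n ^ 2 := by
      rw [abs_div, abs_of_pos hs, div_mul_eq_mul_div]; gcongr
    have f2 : |c / s ^ 3 * a ^ 2| ≤ |c| / s ^ 3 * P ^ 2 * n ^ 2 := by
      rw [abs_mul, abs_div, abs_of_pos (pow_pos hs 3), abs_pow, mul_assoc, ← mul_pow]
      gcongr
    have := abs_le.mp f1
    have := abs_le.mp f2
    rw [abs_le, hu, hD]
    constructor <;> nlinarith [sq_nonneg n]
  have hnn : n ^ 2 ≤ n := by nlinarith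
  have e3 : |u| ≤ C * n := by
    have : |u| ≤ |a / s| + |u - a / s| := by
      simpa using abs_add_le (a / s) (u - a / s)
    have : D * n ^ 2 ≤ D * n := by gcongr
    rw [hC]; linarith
  have e4 : |u + a / s| ≤ 2 * C * n := by
    have := abs_add_le u (a / s)
    have : 0 ≤ D * n := by positivity
    have : C * n = P / s * n + D * n := by rw [hC]; ring
    linarith
  constructor
  · have : 0 ≤ |c| / 2 * (D * (2 * C)) * n := by positivity
    linarith
  · calc c / 2 * (u ^ 2 - (a / s) ^ 2) ≤ |c / 2 * (u ^ 2 - (a / s) ^ 2)| := le_abs_self _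
      _ = |c| / 2 * (|u - a / s| * |u + a / s|) := by
        rw [← abs_mul, abs_mul, abs_div, abs_two]; congr 2; ring
      _ ≤ |c| / 2 * ((D * n ^ 2) * (2 * C * n)) := by gcongr
      _ ≤ _ := by
        have : 0 ≤ C * n ^ 3 := by positivity
        linarith

/-- Transformation of the second-order subjet under a smooth increasing change of unknown:
if `w = φ ∘ v` with `φ` `C²` and `φ' > 0`, `s := φ'(v x)` and `(p,Y) ∈ J^{2,-} w (x)`,
then `(p/s, (1/s) Y - (φ''(v x)/s³) p⊗p) ∈ J^{2,-} v (x)`. -/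
theorem subjet_change_of_unknown
    {N : ℕ} (O : Set (Fin N → ℝ)) (hO : IsOpen O)
    (v : (Fin N → ℝ) → ℝ)
    (φ : ℝ → ℝ) (hφ : ContDiff ℝ 2 φ) (hφ' : ∀ t : ℝ, 0 < deriv φ t)
    (x : Fin N → ℝ) (hx : x ∈ O)
    (p : Fin N → ℝ) (Y : Matrix (Fin N) (Fin N) ℝ)
    (hpY : InSubjet O (φ ∘ v) x p Y) :
    InSubjet O v x ((deriv φ (v x))⁻¹ • p)
      ((deriv φ (v x))⁻¹ • Y -
        (deriv (deriv φ) (v x) / (deriv φ (v x)) ^ 3) • vecMulVec p p) := by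
  obtain ⟨hsym, H⟩ := hpY
  have hs := hφ' (v x)
  have hmono : StrictMono φ := strictMono_of_deriv_pos hφ'
  set s := deriv φ (v x) with hsdef
  set c := deriv (deriv φ) (v x) with hcdef
  refine ⟨?_, fun ε hε => ?_⟩
  · unfold Matrix.IsSymm at *
    rw [transpose_sub, transpose_smul, transpose_smul, hsym, transpose_vecMulVec]
  obtain ⟨P, hP, hPb⟩ := aux_dot p
  obtain ⟨M, hM, hMb⟩ := aux_quad Y
  obtain ⟨C, hC, hCb⟩ := aux_scalar s c P M ε hs hP hM hε
  obtain ⟨δ, hδ, Hδ⟩ := H (s * ε / 4) (by positivity)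
  obtain ⟨r, hr, Hr⟩ := aux_taylor φ hφ (v x) (s * ε / 4 / C ^ 2) (by positivity)
  refine ⟨min (min δ 1) (min (r / (2 * C)) (s * ε / 4 / C)), by positivity, fun y hy hyx => ?_⟩
  simp only [le_min_iff] at hyx
  obtain ⟨⟨n1, n2⟩, n3, n4⟩ := hyx
  have h1 := Hδ y hy n1
  have hPy := hPb (y - x)
  have hMy := hMb (y - x)
  have hn := norm_nonneg (y - x)
  have hform : (y - x) ⬝ᵥ (s⁻¹ • Y - (c / s ^ 3) • vecMulVec p p) *ᵥ (y - x)
      = ((y - x) ⬝ᵥ Y *ᵥ (y - x)) / s - c / s ^ 3 * (p ⬝ᵥ (y - x)) ^ 2 := by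
    rw [sub_mulVec, dotProduct_sub, smul_mulVec, smul_mulVec, dotProduct_smul, dotProduct_smul,
      vecMulVec_mulVec]
    simp only [op_smul_eq_smul, dotProduct_smul, smul_eq_mul]
    rw [dotProduct_comm (y - x) p]
    ring
  rw [hform, smul_dotProduct, smul_eq_mul]
  generalize p ⬝ᵥ (y - x) = a at *
  generalize (y - x) ⬝ᵥ Y *ᵥ (y - x) = b at *
  generalize ‖y - x‖ = n at *
  obtain ⟨g1, g2⟩ := hCb a b n hn n2 hPy hMy _ rfl
  set u := a / s + (1 / 2) * (b / s - c / s ^ 3 * a ^ 2) - ε * n ^ 2 with hu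
  by_contra hcon
  have hlt : v y < v x + u := by
    rw [hu]; rw [ge_iff_le, not_le] at hcon
    have : s⁻¹ * a = a / s := by ring
    linarith
  have h2 := hmono hlt
  have hur : |u| < r := by
    rw [le_div_iff₀ (by positivity)] at n3
    rcases le_or_gt (C * n) 0 with h | h <;> linarith
  have h3 := Hr u hur
  simp only [Function.comp] at h1
  have h4 : s * u = a + b / 2 - c / 2 * (a / s) ^ 2 - s * ε * n ^ 2 := by
    rw [hu]; field_simp
    try ring
  have h5 : s * ε / 4 / C ^ 2 * u ^ 2 ≤ s * ε / 4 * n ^ 2 := by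
    have : u ^ 2 ≤ (C * n) ^ 2 := by
      rw [← sq_abs u]; gcongr
    calc s * ε / 4 / C ^ 2 * u ^ 2 ≤ s * ε / 4 / C ^ 2 * (C * n) ^ 2 := by gcongr
      _ = _ := by field_simp
  have h6 : C * n ^ 3 ≤ s * ε / 4 * n ^ 2 := by
    rw [le_div_iff₀ hC] at n4
    have := mul_le_mul_of_nonneg_right n4 (sq_nonneg n)
    linarith
  have h7 : 0 ≤ s * ε * n ^ 2 := by positivity
  rw [← hsdef, ← hcdef] at h3
  linarith
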